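/- arXiv:2201.02157 — 2 statements merged into one kernel-verified Lean document; each statement's English description precedes it below -/
import Mathlib

section
/- Let Σ be the renewal shift and φ : Σ → ℝ the potential φ(x) = −x_0. Then for every t ≥ 1, P_G(tφ) ≤ log 2 − t. -/
open MeasureTheory Filter Topology BoundedContinuousFunction
open scoped ENNReal NNReal

noncomputable section

/-! ## Countable Markov shifts (one-sided) -/

/-- The one-sided countable Markov shift over the alphabet `ℕ` determined by the
transition matrix (relation) `A`. -/
structure MShift (A : ℕ → ℕ → Prop) : Type where
  seq : ℕ → ℕ
  adm : ∀ i : ℕ, A (seq i) (seq (i + 1))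

/-- The topology generated by the cylinders: the topology induced from the product
topology on `ℕ → ℕ` (with `ℕ` discrete). -/
instance (A : ℕ → ℕ → Prop) : TopologicalSpace (MShift A) :=
  TopologicalSpace.induced MShift.seq inferInstance

/-- The Borel σ-algebra on the shift space. -/
instance (A : ℕ → ℕ → Prop) : MeasurableSpace (MShift A) := borel (MShift A)

instance (A : ℕ → ℕ → Prop) : BorelSpace (MShift A) := ⟨rfl⟩

/-- The shift map `σ`. -/
def shiftMap (A : ℕ → ℕ → Prop) (x : MShift A) : MShift A :=
  ⟨fun i => x.seq (i + 1), fun i => x.adm (i + 1)⟩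

/-- No row and no column of the transition matrix is identically zero. -/
def NoZeroRC (A : ℕ → ℕ → Prop) : Prop :=
  ∀ i : ℕ, (∃ j, A i j) ∧ (∃ j, A j i)

/-- The cylinder `[x₀ … x_{n-1}]` determined by a finite word `w`. -/
def cylSet (A : ℕ → ℕ → Prop) (w : List ℕ) : Set (MShift A) :=
  {x | ∀ i < w.length, x.seq i = w.getD i 0}

/-- A path: an admissible word `x₀ … xₙ` with `n ≥ 1` and nonempty cylinder. -/
def IsPath (A : ℕ → ℕ → Prop) (w : List ℕ) : Prop :=
  2 ≤ w.length ∧ w.Chain' A ∧ (cylSet A w).Nonempty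

/-- The length `l(γ) = n` of a path `γ = x₀ … xₙ` (represented as a list of `n+1` symbols). -/
def pathLen (w : List ℕ) : ℕ := w.length - 1

/-- The weight `φ(γ) = Σ_{k=0}^{n-1} ψ(x_k x_{k+1})` of a word under a Markov
potential determined by `ψ : ℕ → ℕ → ℝ`. -/
def pathWt (ψ : ℕ → ℕ → ℝ) : List ℕ → ℝ
  | [] => 0
  | [_] => 0
  | a :: b :: l => ψ a b + pathWt ψ (b :: l)

/-- Topological transitivity: any two symbols are connected by a path. -/
def TopTrans (A : ℕ → ℕ → Prop) : Prop :=
  ∀ a b : ℕ, ∃ w : List ℕ, IsPath A w ∧ w.headI = a ∧ w.getLastD 0 = b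

/-- The Birkhoff sum `Sₙφ`. -/
def birkhoff (A : ℕ → ℕ → Prop) (φ : MShift A → ℝ) (n : ℕ) (x : MShift A) : ℝ :=
  ∑ i ∈ Finset.range n, φ ((shiftMap A)^[i] x)

/-- The Gurevich partition function `Zₙ(φ, a)`. -/
def Zpart (A : ℕ → ℕ → Prop) (φ : MShift A → ℝ) (n : ℕ) (a : ℕ) : ℝ≥0∞ :=
  ∑' x : {x : MShift A // (shiftMap A)^[n] x = x ∧ x.seq 0 = a},
    ENNReal.ofReal (Real.exp (birkhoff A φ n x.1))

/-- `Zₙ*(φ, a)`: the partition function restricted to first returns to `a`. -/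
def ZpartStar (A : ℕ → ℕ → Prop) (φ : MShift A → ℝ) (n : ℕ) (a : ℕ) : ℝ≥0∞ :=
  ∑' x : {x : MShift A // (shiftMap A)^[n] x = x ∧ x.seq 0 = a ∧
      ∀ k, 0 < k → k < n → x.seq k ≠ a},
    ENNReal.ofReal (Real.exp (birkhoff A φ n x.1))

/-- The Gurevich pressure `P_G(φ) = limsup (1/n) log Zₙ(φ, a)` (at the symbol `a`),
as an extended real number. -/
def PGur (A : ℕ → ℕ → Prop) (φ : MShift A → ℝ) (a : ℕ) : EReal :=
  Filter.atTop.limsup fun n : ℕ => (((n : ℝ)⁻¹ : ℝ) : EReal) * ENNReal.log (Zpart A φ n a)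

/-- `p` is the (common, symbol-independent) value of the Gurevich pressure of `φ`. -/
def IsPG (A : ℕ → ℕ → Prop) (φ : MShift A → ℝ) (p : EReal) : Prop :=
  ∀ a : ℕ, (∃ x : MShift A, x.seq 0 = a) → PGur A φ a = p

/-- `φ` is a summable potential: `Σᵢ exp (sup φ|_[i]) < ∞`. -/
def SummablePot (A : ℕ → ℕ → Prop) (φ : MShift A → ℝ) : Prop :=
  ∃ s : ℕ → ℝ, Summable (fun i => Real.exp (s i)) ∧
    ∀ (i : ℕ) (x : MShift A), x.seq 0 = i → φ x ≤ s i

/-- `V` is a bound for the `n`-th variation `Varₙ(φ)`. -/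
def VarBdd (A : ℕ → ℕ → Prop) (φ : MShift A → ℝ) (n : ℕ) (V : ℝ) : Prop :=
  ∀ x y : MShift A, (∀ i < n, x.seq i = y.seq i) → |φ x - φ y| ≤ V

/-- σ-invariance of a Borel measure on the shift space. -/
def ShiftInv (A : ℕ → ℕ → Prop) (μ : Measure (MShift A)) : Prop :=
  ∀ s : Set (MShift A), MeasurableSet s → μ (shiftMap A ⁻¹' s) = μ s

/-- The maximal ergodic average `α(φ)`. -/
def alphaSup (A : ℕ → ℕ → Prop) (φ : MShift A → ℝ) : ℝ :=
  sSup {r : ℝ | ∃ μ : Measure (MShift A), IsProbabilityMeasure μ ∧ ShiftInv A μ ∧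
    Integrable φ μ ∧ r = ∫ x, φ x ∂μ}

/-- `μ` is the Gurevich–Markov (stationary Markov equilibrium) measure associated to the
Markov potential `ψ` with pressure `p`. -/
structure IsGM (A : ℕ → ℕ → Prop) (ψ : ℕ → ℕ → ℝ) (p : ℝ) (μ : Measure (MShift A)) : Prop where
  prob : IsProbabilityMeasure μ
  inv : ShiftInv A μ
  eigen : ∃ h hT : ℕ → ℝ, (∀ a, 0 < h a) ∧ (∀ a, 0 < hT a) ∧
    (∀ j : ℕ, (∑' a : {a : ℕ // A a j}, ENNReal.ofReal (Real.exp (ψ a.1 j) * h a.1))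
        = ENNReal.ofReal (Real.exp p * h j)) ∧
    (∀ j : ℕ, (∑' b : {b : ℕ // A j b}, ENNReal.ofReal (Real.exp (ψ j b.1) * hT b.1))
        = ENNReal.ofReal (Real.exp p * hT j)) ∧
    (∑' a : ℕ, ENNReal.ofReal (h a * hT a)) = 1 ∧
    (∀ w : List ℕ, w ≠ [] → w.Chain' A → (cylSet A w).Nonempty →
      μ (cylSet A w) = ENNReal.ofReal
        (h w.headI * hT (w.getLastD 0) * Real.exp (pathWt ψ w - (pathLen w : ℝ) * p)))

/-! ## Loops and main paths (one-sided) -/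

/-- A loop at `a`. -/
def IsLoopAt (A : ℕ → ℕ → Prop) (a : ℕ) (w : List ℕ) : Prop :=
  IsPath A w ∧ w.headI = a ∧ w.getLastD 0 = a

/-- The word `w` passes through `b`, i.e. some intermediate symbol of `w` equals `b`. -/
def PassesThrough (w : List ℕ) (b : ℕ) : Prop :=
  ∃ m, 0 < m ∧ m < w.length - 1 ∧ w.getD m 0 = b

/-- No intermediate symbol of `w` lies in `J`. -/
def AvoidsIn (w : List ℕ) (J : Finset ℕ) : Prop :=
  ∀ m, 0 < m → m < w.length - 1 → w.getD m 0 ∉ J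

/-- A first-return loop at `c`: a loop at `c` with no intermediate occurrence of `c`. -/
def FirstRetLoop (A : ℕ → ℕ → Prop) (c : ℕ) (w : List ℕ) : Prop :=
  IsPath A w ∧ w.headI = c ∧ w.getLastD 0 = c ∧
    ∀ m, 0 < m → m < w.length - 1 → w.getD m 0 ≠ c

/-- A main path from `i` to `j` (relative to the pair of symbols `{a, b}`): a path from
`i` to `j` with no intermediate occurrence of `a` nor of `b`. -/
def MainPath (A : ℕ → ℕ → Prop) (a b i j : ℕ) (w : List ℕ) : Prop :=
  IsPath A w ∧ w.headI = i ∧ w.getLastD 0 = j ∧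
    ∀ m, 0 < m → m < w.length - 1 → w.getD m 0 ≠ a ∧ w.getD m 0 ≠ b

/-- `p_{ij}^t`: the sum of `exp(ψ(γ) − l(γ)·p)` over all main paths from `i` to `j`. -/
def pSum (A : ℕ → ℕ → Prop) (ψ : ℕ → ℕ → ℝ) (p : ℝ) (a b i j : ℕ) : ℝ≥0∞ :=
  ∑' w : {w : List ℕ // MainPath A a b i j w},
    ENNReal.ofReal (Real.exp (pathWt ψ w.1 - (pathLen w.1 : ℝ) * p))

/-- `r_{ij}^t`: as `pSum`, restricted to main paths all of whose symbols lie in `S'`. -/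
def rSum (A : ℕ → ℕ → Prop) (ψ : ℕ → ℕ → ℝ) (p : ℝ) (a b i j : ℕ) (S' : Finset ℕ) : ℝ≥0∞ :=
  ∑' w : {w : List ℕ // MainPath A a b i j w ∧ ∀ m < w.length, w.getD m 0 ∈ S'},
    ENNReal.ofReal (Real.exp (pathWt ψ w.1 - (pathLen w.1 : ℝ) * p))

/-- Number of intermediate occurrences of symbols of `I` in the word `w`. -/
def interCount (I : Finset ℕ) (w : List ℕ) : ℕ :=
  ((w.drop 1).take (w.length - 2)).countP (fun s => decide (s ∈ I))

/-- `p_{ij}^t(n)`: as `pSum`, restricted to main paths with exactly `n` intermediate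
occurrences of symbols of `I`. -/
def pSumN (A : ℕ → ℕ → Prop) (ψ : ℕ → ℕ → ℝ) (p : ℝ) (a b i j : ℕ)
    (I : Finset ℕ) (n : ℕ) : ℝ≥0∞ :=
  ∑' w : {w : List ℕ // MainPath A a b i j w ∧ interCount I w = n},
    ENNReal.ofReal (Real.exp (pathWt ψ w.1 - (pathLen w.1 : ℝ) * p))

/-- An `I`-free path from `i` to `j`: a path from `i` to `j` with no intermediate
symbol in `I`. -/
def IFree (A : ℕ → ℕ → Prop) (I : Finset ℕ) (i j : ℕ) (w : List ℕ) : Prop :=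
  IsPath A w ∧ w.headI = i ∧ w.getLastD 0 = j ∧
    ∀ m, 0 < m → m < w.length - 1 → w.getD m 0 ∉ I

/-! ## Two-sided countable Markov shifts -/

/-- The two-sided countable Markov shift determined by `A`. -/
structure MShift2 (A : ℕ → ℕ → Prop) : Type where
  seq : ℤ → ℕ
  adm : ∀ i : ℤ, A (seq i) (seq (i + 1))

instance (A : ℕ → ℕ → Prop) : TopologicalSpace (MShift2 A) :=
  TopologicalSpace.induced MShift2.seq inferInstance

instance (A : ℕ → ℕ → Prop) : MeasurableSpace (MShift2 A) := borel (MShift2 A)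

instance (A : ℕ → ℕ → Prop) : BorelSpace (MShift2 A) := ⟨rfl⟩

/-- The (invertible) shift map on the two-sided shift. -/
def shiftMap2 (A : ℕ → ℕ → Prop) (x : MShift2 A) : MShift2 A :=
  ⟨fun i => x.seq (i + 1), fun i => x.adm (i + 1)⟩

/-- Cylinder based at coordinate 0 in the two-sided shift. -/
def cylSet2 (A : ℕ → ℕ → Prop) (w : List ℕ) : Set (MShift2 A) :=
  {x | ∀ i < w.length, x.seq (i : ℤ) = w.getD i 0}

/-- A path in the two-sided shift: an admissible word `x₀ … xₙ`, `n ≥ 1`. -/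
def IsPath2 (A : ℕ → ℕ → Prop) (w : List ℕ) : Prop :=
  2 ≤ w.length ∧ w.Chain' A

/-- σ-invariance of a Borel measure on the two-sided shift. -/
def ShiftInv2 (A : ℕ → ℕ → Prop) (μ : Measure (MShift2 A)) : Prop :=
  ∀ s : Set (MShift2 A), MeasurableSet s → μ (shiftMap2 A ⁻¹' s) = μ s

/-- Main path from `i` to `j` relative to `{a, b}` in the two-sided shift. -/
def MainPath2 (A : ℕ → ℕ → Prop) (a b i j : ℕ) (w : List ℕ) : Prop :=
  IsPath2 A w ∧ w.headI = i ∧ w.getLastD 0 = j ∧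
    ∀ m, 0 < m → m < w.length - 1 → w.getD m 0 ≠ a ∧ w.getD m 0 ≠ b

/-- `p_{ij}`: the sum of `exp(ψ(γ) − l(γ)·P)` over all main paths from `i` to `j`
in the two-sided shift. -/
def pSum2 (A : ℕ → ℕ → Prop) (ψ : ℕ → ℕ → ℝ) (P : ℝ) (a b i j : ℕ) : ℝ≥0∞ :=
  ∑' w : {w : List ℕ // MainPath2 A a b i j w},
    ENNReal.ofReal (Real.exp (pathWt ψ w.1 - (pathLen w.1 : ℝ) * P))

/-! ## The Ruelle operator and the renewal shift -/

/-- The Ruelle (transfer) operator acting on nonnegative measurable functions. -/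
def ruelleOp (A : ℕ → ℕ → Prop) (ψ : MShift A → ℝ) (f : MShift A → ℝ≥0∞)
    (x : MShift A) : ℝ≥0∞ :=
  ∑' y : {y : MShift A // shiftMap A y = x}, ENNReal.ofReal (Real.exp (ψ y.1)) * f y.1

/-- The transition matrix of the renewal shift: `A(1,1) = A(1,i) = A(i, i-1) = 1` for
every `i > 1`, all other entries `0` (alphabet `{1, 2, …}`). -/
def renewalA : ℕ → ℕ → Prop := fun i j => (i = 1 ∧ 1 ≤ j) ∨ (2 ≤ i ∧ j = i - 1)

/-- The potential `φ(x) = -x₀` on the renewal shift. -/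
def phiRen : MShift renewalA → ℝ := fun x => -(x.seq 0 : ℝ)

/-- The potential `φ(x) = x₀ - x₁` on the renewal shift. -/
def phiRen2 : MShift renewalA → ℝ := fun x => (x.seq 0 : ℝ) - (x.seq 1 : ℝ)

/-- The fixed point `1̄ = (1,1,1,…)` of the renewal shift. -/
def onebar : MShift renewalA := ⟨fun _ => 1, fun _ => Or.inl ⟨rfl, le_refl 1⟩⟩

end

/-- Every symbol of a point of the renewal shift is at least `1`. -/
theorem one_le_seq_renewal (x : MShift renewalA) (i : ℕ) : 1 ≤ x.seq i := by
  rcases x.adm i with h | h <;> omega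

/-- A point of the renewal shift is determined by the positions of the symbol `1`. -/
theorem renewal_ext_of_ones {x y : MShift renewalA} (h : ∀ i, x.seq i = 1 ↔ y.seq i = 1) :
    x = y := by
  have key : ∀ k i, x.seq i = k + 1 → y.seq i = k + 1 := by
    intro k
    induction k with
    | zero => exact fun i hi => (h i).1 hi
    | succ k ih =>
      intro i hi
      have hx := x.adm i
      have hy := y.adm i
      have h1 := h i
      have h2 := ih (i + 1)
      unfold renewalA at hx hy
      omega
  obtain ⟨s, hs⟩ := x
  obtain ⟨s', hs'⟩ := y
  congr
  funext i
  have h1 := one_le_seq_renewal ⟨s, hs⟩ i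
  have h2 := key (s i - 1) i (by simp only at h1 ⊢; omega)
  simp only at h1 h2
  omega

theorem shiftMap_iterate_seq (A : ℕ → ℕ → Prop) (x : MShift A) (n i : ℕ) :
    ((shiftMap A)^[n] x).seq i = x.seq (i + n) := by
  induction n generalizing i with
  | zero => rfl
  | succ n ih =>
    rw [Function.iterate_succ_apply']
    change ((shiftMap A)^[n] x).seq (i + 1) = _
    rw [ih]
    congr 1
    omega

theorem seq_mod_of_periodic {A : ℕ → ℕ → Prop} {x : MShift A} {n : ℕ}
    (hx : (shiftMap A)^[n] x = x) (i : ℕ) : x.seq (i % n) = x.seq i := by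
  have hp : Function.Periodic x.seq n := fun j => by
    rw [← shiftMap_iterate_seq, hx]
  exact hp.map_mod_nat i

/-- A periodic point of the renewal shift is determined by the positions of `1` in one period. -/
theorem ones_injOn_periodic {n : ℕ} (hn : 0 < n) (a : ℕ) :
    Function.Injective
      fun x : {x : MShift renewalA // (shiftMap renewalA)^[n] x = x ∧ x.seq 0 = a} =>
        {i : Fin n | x.1.seq i = 1} := by
  intro x y hxy
  refine Subtype.ext (renewal_ext_of_ones fun i => ?_)
  rw [← seq_mod_of_periodic x.2.1, ← seq_mod_of_periodic y.2.1]
  exact Set.ext_iff.1 hxy ⟨i % n, Nat.mod_lt i hn⟩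

theorem birkhoff_phiRen_le {t : ℝ} (ht : 0 ≤ t) (n : ℕ) (x : MShift renewalA) :
    birkhoff renewalA (fun x => t * phiRen x) n x ≤ -(n * t) := by
  have h : ∀ i ∈ Finset.range n,
      t * phiRen ((shiftMap renewalA)^[i] x) ≤ -t := fun i _ => by
    have h1 : (1 : ℝ) ≤ (((shiftMap renewalA)^[i] x).seq 0 : ℝ) := by
      exact_mod_cast one_le_seq_renewal _ 0
    unfold phiRen
    nlinarith
  calc birkhoff renewalA (fun x => t * phiRen x) n x
      ≤ ∑ _i ∈ Finset.range n, -t := Finset.sum_le_sum h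
    _ = -(n * t) := by simp

theorem Zpart_renewal_le {t : ℝ} (ht : 0 ≤ t) {n : ℕ} (hn : 0 < n) (a : ℕ) :
    Zpart renewalA (fun x => t * phiRen x) n a
      ≤ ENNReal.ofReal (Real.exp (n * (Real.log 2 - t))) := by
  set c := ENNReal.ofReal (Real.exp (-(n * t))) with hc
  calc Zpart renewalA (fun x => t * phiRen x) n a
      ≤ ∑' _x : {x : MShift renewalA // (shiftMap renewalA)^[n] x = x ∧ x.seq 0 = a}, c :=
        ENNReal.tsum_le_tsum fun x => ENNReal.ofReal_le_ofReal
          (Real.exp_le_exp.2 (birkhoff_phiRen_le ht n x.1))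
    _ ≤ ∑' _s : Set (Fin n), c :=
        ENNReal.tsum_comp_le_tsum_of_injective (ones_injOn_periodic hn a) fun _ => c
    _ = 2 ^ n * c := by
        classical
        simp [tsum_fintype, Fintype.card_set]
    _ = ENNReal.ofReal (Real.exp (n * (Real.log 2 - t))) := by
        rw [mul_sub, sub_eq_add_neg, Real.exp_add, ENNReal.ofReal_mul (Real.exp_nonneg _),
          Real.exp_nat_mul, Real.exp_log two_pos, ENNReal.ofReal_pow zero_le_two,
          ENNReal.ofReal_ofNat]

/-- On the renewal shift with `φ(x) = −x₀`: `P_G(tφ) ≤ log 2 − t`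
for every `t ≥ 1`. -/
theorem stmt13 (t : ℝ) (ht : 1 ≤ t) :
    ∀ a : ℕ, 1 ≤ a →
      PGur renewalA (fun x => t * phiRen x) a ≤ ((Real.log 2 - t : ℝ) : EReal) := by
  intro a _
  refine Filter.limsup_le_of_le (by isBoundedDefault) ?_
  filter_upwards [eventually_gt_atTop 0] with n hn
  have hn' : (n : ℝ) ≠ 0 := by positivity
  calc (((n : ℝ)⁻¹ : ℝ) : EReal) * ENNReal.log (Zpart renewalA (fun x => t * phiRen x) n a)
      ≤ (((n : ℝ)⁻¹ : ℝ) : EReal) * ((n * (Real.log 2 - t) : ℝ) : EReal) := by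
        refine mul_le_mul_of_nonneg_left ?_ (EReal.coe_nonneg.2 (by positivity))
        refine (ENNReal.log_monotone (Zpart_renewal_le (zero_le_one.trans ht) hn a)).trans ?_
        rw [ENNReal.log_ofReal_of_pos (Real.exp_pos _), Real.log_exp]
    _ = ((Real.log 2 - t : ℝ) : EReal) := by
        rw [← EReal.coe_mul, inv_mul_cancel_left₀ hn']
end

section
/- Let Σ be the renewal shift, φ(x) = −x_0, and t ≥ 1. Suppose ν is a Borel measure on Σ with 0 < ν([i]) < ∞ for every i ∈ ℕ and ∫ L_{tφ} f dν = e^{P_G(tφ)} ∫ f dν for every Borel measurable f : Σ → [0, ∞]. Then for every a ∈ ℕ: ν([a]) = exp(−t·(a+2)(a−1)/2 − (a−1)·P_G(tφ))·ν([1]). -/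
open MeasureTheory Filter Topology BoundedContinuousFunction
open scoped ENNReal NNReal

theorem MShift.ext_seq {A : ℕ → ℕ → Prop} {x y : MShift A} (h : x.seq = y.seq) : x = y := by
  cases x; cases y; cases h; rfl

theorem MShift.ext_of_shiftMap_eq {A : ℕ → ℕ → Prop} {x y : MShift A}
    (h0 : x.seq 0 = y.seq 0) (h : shiftMap A x = shiftMap A y) : x = y := by
  refine MShift.ext_seq (funext fun i => ?_)
  cases i with
  | zero => exact h0
  | succ i => exact congrFun (congrArg MShift.seq h) i

/-- The point `a x₀ x₁ …` obtained by prepending an admissible symbol. -/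
def MShift.cons {A : ℕ → ℕ → Prop} (a : ℕ) (x : MShift A) (h : A a (x.seq 0)) : MShift A where
  seq
    | 0 => a
    | i + 1 => x.seq i
  adm
    | 0 => h
    | i + 1 => x.adm i

theorem mem_cylSet_singleton {A : ℕ → ℕ → Prop} {a : ℕ} {x : MShift A} :
    x ∈ cylSet A [a] ↔ x.seq 0 = a := by
  simp [cylSet]

theorem measurableSet_cylSet_singleton (A : ℕ → ℕ → Prop) (a : ℕ) :
    MeasurableSet (cylSet A [a]) := by
  have hc : Continuous fun x : MShift A => x.seq 0 :=
    (continuous_apply 0).comp continuous_induced_dom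
  have he : cylSet A [a] = (fun x : MShift A => x.seq 0) ⁻¹' {a} :=
    Set.ext fun x => by simp [mem_cylSet_singleton]
  rw [he]
  exact ((isOpen_discrete {a}).preimage hc).measurableSet

/-- If `ψ` equals the constant `c` on `[a]` and `b` is the only symbol that may follow `a`, the
Ruelle operator maps the indicator of `[a]` to `exp c` times the indicator of `[b]`. -/
theorem ruelleOp_indicator_cylSet {A : ℕ → ℕ → Prop} {ψ : MShift A → ℝ} {a b : ℕ} {c : ℝ}
    (hψ : ∀ y : MShift A, y.seq 0 = a → ψ y = c) (hab : ∀ j, A a j ↔ j = b) :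
    ruelleOp A ψ ((cylSet A [a]).indicator 1) =
      (cylSet A [b]).indicator fun _ => ENNReal.ofReal (Real.exp c) := by
  funext x
  by_cases hx : x.seq 0 = b
  · rw [Set.indicator_of_mem (mem_cylSet_singleton.2 hx), ruelleOp,
      tsum_eq_single ⟨x.cons a ((hab _).2 hx), rfl⟩]
    · have h0 : (x.cons a ((hab _).2 hx)).seq 0 = a := rfl
      simp [Set.indicator_of_mem (mem_cylSet_singleton.2 h0), hψ _ h0]
    · rintro ⟨y, hy⟩ hne
      have hya : y ∉ cylSet A [a] := fun hmem =>
        hne (Subtype.ext (MShift.ext_of_shiftMap_eq (mem_cylSet_singleton.1 hmem) hy))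
      simp [Set.indicator_of_notMem hya]
  · rw [Set.indicator_of_notMem (mt mem_cylSet_singleton.1 hx), ruelleOp, ENNReal.tsum_eq_zero]
    rintro ⟨y, hy⟩
    have hya : y ∉ cylSet A [a] := fun hmem => by
      have hA := y.adm 0
      rw [mem_cylSet_singleton.1 hmem, hab] at hA
      exact hx (by rw [← hy]; exact hA)
    simp [Set.indicator_of_notMem hya]

theorem renewalA_succ_iff {n : ℕ} (hn : 1 ≤ n) (j : ℕ) : renewalA (n + 1) j ↔ j = n := by
  unfold renewalA
  omega

/-- The recursion `ν [n + 1] = exp (-t (n + 1) - P) ν [n]` for an eigenmeasure `ν`. -/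
theorem eigenmeasure_cylSet_succ {t P : ℝ} {ν : Measure (MShift renewalA)}
    (heig : ∀ f : MShift renewalA → ℝ≥0∞, Measurable f →
      ∫⁻ x, ruelleOp renewalA (fun y => t * phiRen y) f x ∂ν
        = ENNReal.ofReal (Real.exp P) * ∫⁻ x, f x ∂ν) {n : ℕ} (hn : 1 ≤ n) :
    ν (cylSet renewalA [n + 1]) =
      ENNReal.ofReal (Real.exp (-(t * (n + 1)) - P)) * ν (cylSet renewalA [n]) := by
  have h := heig ((cylSet renewalA [n + 1]).indicator 1)
    (measurable_one.indicator (measurableSet_cylSet_singleton _ _))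
  have hψ : ∀ y : MShift renewalA, y.seq 0 = n + 1 → t * phiRen y = -(t * (n + 1)) := by
    intro y hy
    simp only [phiRen, hy]
    push_cast
    ring
  rw [ruelleOp_indicator_cylSet hψ (renewalA_succ_iff hn),
    lintegral_indicator_const (measurableSet_cylSet_singleton _ _),
    lintegral_indicator_one (measurableSet_cylSet_singleton _ _)] at h
  rw [sub_eq_neg_add, Real.exp_add, ENNReal.ofReal_mul (Real.exp_pos _).le, mul_assoc, h,
    ← mul_assoc, ← ENNReal.ofReal_mul (Real.exp_pos _).le, ← Real.exp_add]
  simp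

/-- On the renewal shift with `φ(x) = −x₀`, an eigenmeasure `ν` of the
dual Ruelle operator satisfies
`ν([a]) = exp(−t(a+2)(a−1)/2 − (a−1)·P_G(tφ))·ν([1])` for every `a ≥ 1`. -/
theorem stmt16 (t : ℝ) (ht : 1 ≤ t) (P : ℝ)
    (hP : IsPG renewalA (fun x => t * phiRen x) ((P : ℝ) : EReal))
    (ν : Measure (MShift renewalA))
    (hν : ∀ i : ℕ, 1 ≤ i → 0 < ν (cylSet renewalA [i]) ∧ ν (cylSet renewalA [i]) < ⊤)
    (heig : ∀ f : MShift renewalA → ℝ≥0∞, Measurable f →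
      ∫⁻ x, ruelleOp renewalA (fun y => t * phiRen y) f x ∂ν
        = ENNReal.ofReal (Real.exp P) * ∫⁻ x, f x ∂ν) :
    ∀ a : ℕ, 1 ≤ a →
      ν (cylSet renewalA [a])
        = ENNReal.ofReal (Real.exp (-(t * (((a : ℝ) + 2) * ((a : ℝ) - 1) / 2))
            - ((a : ℝ) - 1) * P)) * ν (cylSet renewalA [1]) := by
  intro a ha
  induction a, ha using Nat.le_induction with
  | base => simp
  | succ n hn ih =>
    rw [eigenmeasure_cylSet_succ heig hn, ih, ← mul_assoc,
      ← ENNReal.ofReal_mul (Real.exp_pos _).le, ← Real.exp_add]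
    congr 3
    push_cast
    ring
end
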